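/- arXiv:2401.16368 — 2 statements merged into one kernel-verified Lean document; each statement's English description precedes it below -/
import Mathlib

section
/- Let 0 < δ < r and let φ : ℝ² \ {0} → ℝ² be the reflection across the circle of radius r, φ(x) = (2r/‖x‖ − 1)·x. Then for every continuously differentiable function w : ℝ² → ℝ, ∫_{{x : r−δ < ‖x‖ < r}} ‖D(w∘φ)(x)‖² dx ≤ ((r+δ)/(r−δ))² · ∫_{{x : r < ‖x‖ < r+δ}} ‖Dw(x)‖² dx, where D denotes the Fréchet derivative, ‖·‖ its operator norm, and the integrals are with respect to Lebesgue measure on ℝ². -/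
open MeasureTheory

/-- The derivative at `x` of the radial map `y ↦ (a / ‖y‖ - 1) • y`. -/
noncomputable def radialReflectionFDeriv (a : ℝ) (x : EuclideanSpace ℝ (Fin 2)) :
    EuclideanSpace ℝ (Fin 2) →L[ℝ] EuclideanSpace ℝ (Fin 2) :=
  (a / ‖x‖ - 1) • ContinuousLinearMap.id ℝ _ - ((a / ‖x‖ ^ 3) • innerSL ℝ x).smulRight x

theorem radialReflectionFDeriv_apply (a : ℝ) (x v : EuclideanSpace ℝ (Fin 2)) :
    radialReflectionFDeriv a x v = (a / ‖x‖ - 1) • v - (a / ‖x‖ ^ 3 * inner ℝ x v) • x := by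
  simp [radialReflectionFDeriv]

theorem hasFDerivAt_radialReflection (a : ℝ) {x : EuclideanSpace ℝ (Fin 2)} (hx : x ≠ 0) :
    HasFDerivAt (fun y : EuclideanSpace ℝ (Fin 2) => (a / ‖y‖ - 1) • y)
      (radialReflectionFDeriv a x) x := by
  have hn : ‖x‖ ≠ 0 := norm_ne_zero_iff.mpr hx
  have hnorm : HasFDerivAt (fun y : EuclideanSpace ℝ (Fin 2) => ‖y‖)
      (‖x‖⁻¹ • innerSL ℝ x) x := by
    have h := ((hasStrictFDerivAt_norm_sq x).hasFDerivAt).sqrt (pow_ne_zero 2 hn)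
    simp only [Real.sqrt_sq (norm_nonneg _)] at h
    refine h.congr_fderiv ?_
    ext v
    simp
    field_simp
  have hcoef : HasFDerivAt (fun y : EuclideanSpace ℝ (Fin 2) => a / ‖y‖ - 1)
      ((-a / ‖x‖ ^ 2) • (‖x‖⁻¹ • innerSL ℝ x)) x := by
    have h : HasDerivAt (fun s : ℝ => a / s - 1) (-a / ‖x‖ ^ 2) ‖x‖ := by
      simpa using ((hasDerivAt_const ‖x‖ a).fun_div (hasDerivAt_id' ‖x‖) hn).sub_const 1
    exact h.comp_hasFDerivAt x hnorm
  refine (hcoef.smul (hasFDerivAt_id x)).congr_fderiv ?_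
  ext1 v
  rw [radialReflectionFDeriv_apply]
  simp only [add_apply, smul_apply,
    ContinuousLinearMap.smulRight_apply, innerSL_apply_apply, ContinuousLinearMap.id_apply,
    smul_eq_mul, id, sub_eq_add_neg _ ((a / ‖x‖ ^ 3 * inner ℝ x v) • x), ← neg_smul]
  congr 2
  field_simp

theorem det_radialReflectionFDeriv (a : ℝ) {x : EuclideanSpace ℝ (Fin 2)} (hx : x ≠ 0) :
    (radialReflectionFDeriv a x).det = -(a / ‖x‖ - 1) := by
  have hn : ‖x‖ ≠ 0 := norm_ne_zero_iff.mpr hx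
  have hsq : ‖x‖ ^ 2 = x 0 ^ 2 + x 1 ^ 2 := by
    simp [EuclideanSpace.real_norm_sq_eq]
  have hdet : (radialReflectionFDeriv a x).det = (a / ‖x‖ - 1) ^ 2
      - (a / ‖x‖ - 1) * (a / ‖x‖ ^ 3) * (x 0 ^ 2 + x 1 ^ 2) := by
    rw [ContinuousLinearMap.det,
      ← LinearMap.det_toMatrix (EuclideanSpace.basisFun (Fin 2) ℝ).toBasis, Matrix.det_fin_two]
    simp [LinearMap.toMatrix_apply, radialReflectionFDeriv_apply, EuclideanSpace.inner_single_right]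
    ring
  rw [hdet, ← hsq]
  field_simp
  ring

theorem norm_radialReflectionFDeriv_le {a : ℝ} {x : EuclideanSpace ℝ (Fin 2)} (hx : x ≠ 0)
    (hxa : 2 * ‖x‖ ≤ a) : ‖radialReflectionFDeriv a x‖ ≤ a / ‖x‖ - 1 := by
  have hn : 0 < ‖x‖ := norm_pos_iff.mpr hx
  have htwo : 2 ≤ a / ‖x‖ := by rwa [le_div_iff₀ hn]
  have ha : 0 ≤ a := by linarith
  refine ContinuousLinearMap.opNorm_le_bound _ (by linarith) fun v => ?_
  refine le_of_sq_le_sq ?_ (mul_nonneg (by linarith) (norm_nonneg v))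
  rw [radialReflectionFDeriv_apply, norm_sub_sq_real, norm_smul, norm_smul, inner_smul_left,
    inner_smul_right, real_inner_comm x v, mul_pow, mul_pow, mul_pow, Real.norm_eq_abs,
    Real.norm_eq_abs, sq_abs, sq_abs]
  simp only [conj_trivial]
  have hkey : 0 ≤ (a / ‖x‖ ^ 3) * inner ℝ x v ^ 2 * (a / ‖x‖ - 2) :=
    mul_nonneg (by positivity) (by linarith)
  have hpow : a / ‖x‖ ^ 3 * ‖x‖ ^ 2 = a / ‖x‖ := by field_simp
  linear_combination hkey + (a / ‖x‖ ^ 3) * inner ℝ x v ^ 2 * hpow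

theorem norm_radialReflection {a : ℝ} {x : EuclideanSpace ℝ (Fin 2)} (hx : x ≠ 0)
    (hxa : ‖x‖ ≤ a) : ‖(a / ‖x‖ - 1) • x‖ = a - ‖x‖ := by
  have hn : 0 < ‖x‖ := norm_pos_iff.mpr hx
  have hone : 1 ≤ a / ‖x‖ := by rwa [le_div_iff₀ hn, one_mul]
  rw [norm_smul, Real.norm_of_nonneg (by linarith)]
  field_simp

theorem radialReflection_involutive {a : ℝ} {x : EuclideanSpace ℝ (Fin 2)} (hx : x ≠ 0)
    (hxa : ‖x‖ < a) :
    (a / ‖(a / ‖x‖ - 1) • x‖ - 1) • (a / ‖x‖ - 1) • x = x := by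
  have hn : 0 < ‖x‖ := norm_pos_iff.mpr hx
  have hsub : a - ‖x‖ ≠ 0 := by linarith
  rw [norm_radialReflection hx hxa.le, smul_smul]
  convert one_smul ℝ x
  field_simp
  ring

/-- Bound for the global reflection operator `R₊` at a circular interface in 2D:
with `φ(x) = (2r/‖x‖ − 1)·x` the reflection across the circle of radius `r`, for every
`C¹` function `w` one has
`∫_{r−δ<‖x‖<r} ‖D(w∘φ)‖² ≤ ((r+δ)/(r−δ))² ∫_{r<‖x‖<r+δ} ‖Dw‖²`. -/
theorem circle_reflection_energy_bound_outer_to_inner (r δ : ℝ) (hδ : 0 < δ) (hδr : δ < r)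
    (φ : EuclideanSpace ℝ (Fin 2) → EuclideanSpace ℝ (Fin 2))
    (hφ : ∀ x : EuclideanSpace ℝ (Fin 2), x ≠ 0 → φ x = (2 * r / ‖x‖ - 1) • x)
    (w : EuclideanSpace ℝ (Fin 2) → ℝ) (hw : ContDiff ℝ 1 w) :
    ∫ x in {x : EuclideanSpace ℝ (Fin 2) | r - δ < ‖x‖ ∧ ‖x‖ < r},
        ‖fderiv ℝ (w ∘ φ) x‖ ^ 2 ≤
      ((r + δ) / (r - δ)) ^ 2 *
        ∫ x in {x : EuclideanSpace ℝ (Fin 2) | r < ‖x‖ ∧ ‖x‖ < r + δ},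
          ‖fderiv ℝ w x‖ ^ 2 := by
  set innerAnnulus : Set (EuclideanSpace ℝ (Fin 2)) := {x | r - δ < ‖x‖ ∧ ‖x‖ < r} with h_inner
  set outerAnnulus : Set (EuclideanSpace ℝ (Fin 2)) := {x | r < ‖x‖ ∧ ‖x‖ < r + δ} with h_outer
  have ne_zero : ∀ x : EuclideanSpace ℝ (Fin 2), r - δ < ‖x‖ → x ≠ 0 := fun x hx =>
    norm_pos_iff.mp (by linarith)
  have h_meas : MeasurableSet innerAnnulus :=
    (measurableSet_lt measurable_const measurable_norm).inter
      (measurableSet_lt measurable_norm measurable_const)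
  have h_deriv : ∀ x ∈ innerAnnulus, HasFDerivAt φ (radialReflectionFDeriv (2 * r) x) x := by
    intro x hx
    have hx0 := ne_zero x hx.1
    refine (hasFDerivAt_radialReflection (2 * r) hx0).congr_of_eventuallyEq ?_
    filter_upwards [isOpen_ne.mem_nhds hx0] with y hy using hφ y hy
  have h_norm : ∀ x : EuclideanSpace ℝ (Fin 2), x ≠ 0 → ‖x‖ ≤ 2 * r → ‖φ x‖ = 2 * r - ‖x‖ :=
    fun x hx hxr => by rw [hφ x hx, norm_radialReflection hx hxr]
  have h_invol : ∀ x : EuclideanSpace ℝ (Fin 2), x ≠ 0 → ‖x‖ < 2 * r → φ (φ x) = x := by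
    intro x hx hxr
    have hφx : φ x ≠ 0 := norm_pos_iff.mp (by rw [h_norm x hx hxr.le]; linarith)
    rw [hφ _ hφx, hφ x hx, radialReflection_involutive hx hxr]
  have h_inj : Set.InjOn φ innerAnnulus := by
    intro x hx y hy hxy
    rw [← h_invol x (ne_zero x hx.1) (by linarith [hx.2]), hxy,
      h_invol y (ne_zero y hy.1) (by linarith [hy.2])]
  have h_image : φ '' innerAnnulus = outerAnnulus := by
    ext y
    constructor
    · rintro ⟨x, ⟨hx1, hx2⟩, rfl⟩
      rw [h_outer, Set.mem_ofPred_eq, h_norm x (ne_zero x hx1) (by linarith)]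
      constructor <;> linarith
    · rintro ⟨hy1, hy2⟩
      have hy0 := ne_zero y (by linarith)
      refine ⟨φ y, ?_, h_invol y hy0 (by linarith)⟩
      rw [h_inner, Set.mem_ofPred_eq, h_norm y hy0 (by linarith)]
      constructor <;> linarith
  have h_int : IntegrableOn (fun x => ‖fderiv ℝ w x‖ ^ 2) outerAnnulus := by
    have h_cont : Continuous fun x => ‖fderiv ℝ w x‖ ^ 2 :=
      (hw.continuous_fderiv one_ne_zero).norm.pow 2
    refine (h_cont.continuousOn.integrableOn_compact
      (isCompact_closedBall (0 : EuclideanSpace ℝ (Fin 2)) (r + δ))).mono_set fun x hx => ?_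
    simpa using hx.2.le
  have h_within := fun x hx => (h_deriv x hx).hasFDerivWithinAt (s := innerAnnulus)
  rw [← h_image] at h_int ⊢
  rw [integrableOn_image_iff_integrableOn_abs_det_fderiv_smul volume h_meas h_within h_inj] at h_int
  rw [integral_image_eq_integral_abs_det_fderiv_smul volume h_meas h_within h_inj,
    ← integral_const_mul]
  refine integral_mono_of_nonneg (.of_forall fun x => by positivity) (h_int.const_mul _) ?_
  filter_upwards [ae_restrict_mem h_meas] with x hx
  have hx0 := ne_zero x hx.1
  have hn : 0 < ‖x‖ := norm_pos_iff.mpr hx0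
  have hone : 1 ≤ 2 * r / ‖x‖ - 1 := by
    rw [le_sub_iff_add_le, le_div_iff₀ hn]; linarith [hx.2]
  have hle : 2 * r / ‖x‖ - 1 ≤ (r + δ) / (r - δ) := by
    have h : 2 * r / ‖x‖ ≤ 2 * r / (r - δ) :=
      div_le_div_of_nonneg_left (by linarith) (by linarith) hx.1.le
    have hrδ : r - δ ≠ 0 := by linarith
    calc 2 * r / ‖x‖ - 1 ≤ 2 * r / (r - δ) - 1 := by linarith
      _ = (r + δ) / (r - δ) := by field_simp; ring
  have h_chain : fderiv ℝ (w ∘ φ) x = (fderiv ℝ w (φ x)).comp (radialReflectionFDeriv (2 * r) x) :=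
    (((hw.differentiable one_ne_zero) (φ x)).hasFDerivAt.comp x (h_deriv x hx)).fderiv
  have h_bound : ‖fderiv ℝ (w ∘ φ) x‖ ≤ (r + δ) / (r - δ) * ‖fderiv ℝ w (φ x)‖ := by
    rw [h_chain, mul_comm (_ / _)]
    refine (ContinuousLinearMap.opNorm_comp_le _ _).trans ?_
    exact mul_le_mul_of_nonneg_left
      ((norm_radialReflectionFDeriv_le hx0 (by linarith [hx.2])).trans hle) (norm_nonneg _)
  simp only [smul_eq_mul]
  rw [det_radialReflectionFDeriv _ hx0, abs_neg, abs_of_nonneg (by linarith)]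
  calc ‖fderiv ℝ (w ∘ φ) x‖ ^ 2 ≤ ((r + δ) / (r - δ) * ‖fderiv ℝ w (φ x)‖) ^ 2 := by gcongr
    _ = ((r + δ) / (r - δ)) ^ 2 * (1 * ‖fderiv ℝ w (φ x)‖ ^ 2) := by ring
    _ ≤ _ := by gcongr
end

section
/- Let 0 < δ < r and let φ : ℝ³ \ {0} → ℝ³ be the reflection across the sphere of radius r, φ(x) = (2r/‖x‖ − 1)·x. Then for every continuously differentiable function w : ℝ³ → ℝ, ∫_{{x : r−δ < ‖x‖ < r}} ‖D(w∘φ)(x)‖² dx ≤ ∫_{{x : r < ‖x‖ < r+δ}} ‖Dw(x)‖² dx, where D denotes the Fréchet derivative, ‖·‖ its operator norm, and the integrals are with respect to Lebesgue measure on ℝ³. -/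
open MeasureTheory

section SphereReflection

variable {E : Type*} [NormedAddCommGroup E] [InnerProductSpace ℝ E]

/-- The derivative at `x ≠ 0` of the reflection `x ↦ (2 * r / ‖x‖ - 1) • x` across the sphere
of radius `r`. -/
noncomputable def sphereReflectionFDeriv (r : ℝ) (x : E) : E →L[ℝ] E :=
  (2 * r / ‖x‖ - 1) • ContinuousLinearMap.id ℝ E -
    (2 * r / ‖x‖ ^ 3) • (innerSL ℝ x).smulRight x

theorem sphereReflectionFDeriv_apply (r : ℝ) (x v : E) :
    sphereReflectionFDeriv r x v =
      (2 * r / ‖x‖ - 1) • v - (2 * r / ‖x‖ ^ 3 * inner ℝ x v) • x := by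
  simp [sphereReflectionFDeriv, mul_smul]

theorem hasFDerivAt_norm_of_ne_zero {x : E} (hx : x ≠ 0) :
    HasFDerivAt (fun y : E => ‖y‖) (‖x‖⁻¹ • innerSL ℝ x) x := by
  have hx' : ‖x‖ ≠ 0 := norm_ne_zero_iff.2 hx
  have h := (hasStrictFDerivAt_norm_sq x).hasFDerivAt.sqrt (pow_ne_zero 2 hx')
  simp only [Real.sqrt_sq (norm_nonneg _)] at h
  convert h using 1
  ext v
  simp
  field_simp

theorem hasFDerivAt_sphereReflection (r : ℝ) {x : E} (hx : x ≠ 0) :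
    HasFDerivAt (fun y : E => (2 * r / ‖y‖ - 1) • y) (sphereReflectionFDeriv r x) x := by
  have hx' : ‖x‖ ≠ 0 := norm_ne_zero_iff.2 hx
  have h := (((hasDerivAt_inv hx').const_mul (2 * r)).comp_hasFDerivAt x
    (hasFDerivAt_norm_of_ne_zero hx)).sub_const 1 |>.smul (hasFDerivAt_id x)
  refine h.congr_fderiv ?_
  ext v
  rw [sphereReflectionFDeriv_apply]
  simp [div_eq_mul_inv, sub_eq_add_neg, smul_smul]
  congr 2
  ring

theorem norm_sphereReflectionFDeriv_le {r : ℝ} {x : E} (hx : x ≠ 0) (hxr : ‖x‖ ≤ r) :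
    ‖sphereReflectionFDeriv r x‖ ≤ 2 * r / ‖x‖ - 1 := by
  have hx' : 0 < ‖x‖ := norm_pos_iff.2 hx
  have ha : 0 ≤ 2 * r / ‖x‖ - 1 := by
    rw [sub_nonneg, le_div_iff₀ hx']; linarith
  refine ContinuousLinearMap.opNorm_le_bound _ ha fun v => ?_
  refine le_of_sq_le_sq ?_ (by positivity)
  rw [sphereReflectionFDeriv_apply, norm_sub_sq_real, inner_smul_left, inner_smul_right,
    norm_smul, norm_smul, real_inner_comm x v]
  simp only [mul_pow, Real.norm_eq_abs, sq_abs, conj_trivial]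
  have key : (2 * r / ‖x‖ - 1) ^ 2 * ‖v‖ ^ 2 -
      2 * ((2 * r / ‖x‖ - 1) * (2 * r / ‖x‖ ^ 3 * inner ℝ x v * inner ℝ x v)) +
      (2 * r / ‖x‖ ^ 3) ^ 2 * inner ℝ x v ^ 2 * ‖x‖ ^ 2 =
      (2 * r / ‖x‖ - 1) ^ 2 * ‖v‖ ^ 2 -
        4 * r * (r - ‖x‖) / ‖x‖ ^ 4 * inner ℝ x v ^ 2 := by
    field_simp
    ring
  rw [key]
  have : 0 ≤ 4 * r * (r - ‖x‖) / ‖x‖ ^ 4 * inner ℝ x v ^ 2 := by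
    have : 0 ≤ r := hx'.le.trans hxr
    have : 0 ≤ r - ‖x‖ := by linarith
    positivity
  linarith

theorem det_sphereReflectionFDeriv [FiniteDimensional ℝ E] {r : ℝ} {x : E} (hx : x ≠ 0)
    (hxr : 2 * r ≠ ‖x‖) :
    (sphereReflectionFDeriv r x).det =
      -(2 * r / ‖x‖ - 1) ^ (Module.finrank ℝ E - 1) := by
  have hx' : ‖x‖ ≠ 0 := norm_ne_zero_iff.2 hx
  set a := 2 * r / ‖x‖ - 1 with ha
  have ha0 : a ≠ 0 := by
    rw [ha, sub_ne_zero]; intro h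
    rw [div_eq_one_iff_eq hx'] at h; exact hxr h
  have hmap : (sphereReflectionFDeriv r x : E →ₗ[ℝ] E) = a • LinearMap.transvection
      ((-(a⁻¹ * (2 * r / ‖x‖ ^ 3))) • (innerSL ℝ x : E →ₗ[ℝ] ℝ)) x := by
    ext v
    rw [ContinuousLinearMap.coe_coe, sphereReflectionFDeriv_apply, ← ha]
    simp [LinearMap.transvection.apply, smul_smul, sub_eq_add_neg]
    field_simp
  have : Nontrivial E := ⟨x, 0, hx⟩
  obtain ⟨n, hn⟩ := Nat.exists_eq_succ_of_ne_zero (Module.finrank_pos (R := ℝ) (M := E)).ne'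
  rw [ContinuousLinearMap.det, hmap, LinearMap.det_smul, LinearMap.transvection.det, hn]
  have h1 : a * (1 + -(a⁻¹ * (2 * r / ‖x‖ ^ 3)) * ‖x‖ ^ 2) = -1 := by
    rw [mul_add, ← mul_assoc, mul_neg, mul_inv_cancel_left₀ ha0, ha]
    field_simp
    ring
  simp only [LinearMap.smul_apply, ContinuousLinearMap.coe_coe, innerSL_apply_apply,
    real_inner_self_eq_norm_sq, smul_eq_mul, Nat.succ_eq_add_one, Nat.add_sub_cancel, pow_succ,
    mul_assoc] at h1 ⊢
  rw [h1]
  ring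

theorem norm_sphereReflection {r : ℝ} {x : E} (hx : x ≠ 0) (hxr : ‖x‖ ≤ 2 * r) :
    ‖(2 * r / ‖x‖ - 1) • x‖ = 2 * r - ‖x‖ := by
  have hx' : 0 < ‖x‖ := norm_pos_iff.2 hx
  have ha : 0 ≤ 2 * r / ‖x‖ - 1 := by
    rw [sub_nonneg, le_div_iff₀ hx']; linarith
  rw [norm_smul, Real.norm_of_nonneg ha]
  field_simp

theorem sphereReflection_sphereReflection {r : ℝ} {x : E} (hx : x ≠ 0) (hxr : ‖x‖ < 2 * r) :
    (2 * r / ‖(2 * r / ‖x‖ - 1) • x‖ - 1) • (2 * r / ‖x‖ - 1) • x = x := by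
  have hx' : 0 < ‖x‖ := norm_pos_iff.2 hx
  have h : 2 * r - ‖x‖ ≠ 0 := by linarith
  rw [norm_sphereReflection hx hxr.le, smul_smul]
  convert one_smul ℝ x
  field_simp
  ring

end SphereReflection

/-- Bound for the global reflection operator `R₊` at a spherical interface in 3D
(normal pointing towards the inner domain): with `φ(x) = (2r/‖x‖ − 1)·x` the
reflection across the sphere of radius `r`, for every `C¹` function `w` one has
`∫_{r−δ<‖x‖<r} ‖D(w∘φ)‖² ≤ ∫_{r<‖x‖<r+δ} ‖Dw‖²`. -/
theorem sphere_reflection_energy_bound_outer_to_inner (r δ : ℝ) (hδ : 0 < δ) (hδr : δ < r)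
    (φ : EuclideanSpace ℝ (Fin 3) → EuclideanSpace ℝ (Fin 3))
    (hφ : ∀ x : EuclideanSpace ℝ (Fin 3), x ≠ 0 → φ x = (2 * r / ‖x‖ - 1) • x)
    (w : EuclideanSpace ℝ (Fin 3) → ℝ) (hw : ContDiff ℝ 1 w) :
    ∫ x in {x : EuclideanSpace ℝ (Fin 3) | r - δ < ‖x‖ ∧ ‖x‖ < r},
        ‖fderiv ℝ (w ∘ φ) x‖ ^ 2 ≤
      ∫ x in {x : EuclideanSpace ℝ (Fin 3) | r < ‖x‖ ∧ ‖x‖ < r + δ},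
        ‖fderiv ℝ w x‖ ^ 2 := by
  set S := {x : EuclideanSpace ℝ (Fin 3) | r - δ < ‖x‖ ∧ ‖x‖ < r} with hS
  set T := {x : EuclideanSpace ℝ (Fin 3) | r < ‖x‖ ∧ ‖x‖ < r + δ} with hT
  have hSm : MeasurableSet S :=
    ((isOpen_lt continuous_const continuous_norm).inter
      (isOpen_lt continuous_norm continuous_const)).measurableSet
  have hS0 : ∀ x ∈ S, x ≠ 0 := by
    rintro x ⟨h1, h2⟩ rfl
    rw [norm_zero] at h1
    linarith
  have hd : ∀ x ∈ S, HasFDerivAt φ (sphereReflectionFDeriv r x) x := fun x hx =>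
    (hasFDerivAt_sphereReflection r (hS0 x hx)).congr_of_eventuallyEq <| by
      filter_upwards [isOpen_ne.mem_nhds (hS0 x hx)] with y hy using hφ y hy
  have hinvol : ∀ x : EuclideanSpace ℝ (Fin 3), x ≠ 0 → ‖x‖ < 2 * r → φ (φ x) = x := by
    intro x hx hxr
    have hne : φ x ≠ 0 := by
      rw [← norm_ne_zero_iff, hφ x hx, norm_sphereReflection hx hxr.le]
      linarith
    rw [hφ _ hne, hφ x hx, sphereReflection_sphereReflection hx hxr]
  have hinj : Set.InjOn φ S := by
    intro x hx y hy hxy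
    rw [← hinvol x (hS0 x hx) (by linarith [hx.2]), hxy,
      hinvol y (hS0 y hy) (by linarith [hy.2])]
  have himage : φ '' S = T := by
    ext y
    constructor
    · rintro ⟨x, hx, rfl⟩
      have h := norm_sphereReflection (hS0 x hx) (r := r) (by linarith [hx.2])
      rw [← hφ x (hS0 x hx)] at h
      exact ⟨by linarith [hx.2], by linarith [hx.1]⟩
    · intro hy
      have hy0 : y ≠ 0 := by
        rw [← norm_pos_iff]; linarith [hy.1]
      have h := norm_sphereReflection hy0 (r := r) (by linarith [hy.2])
      rw [← hφ y hy0] at h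
      exact ⟨φ y, ⟨by linarith [hy.2], by linarith [hy.1]⟩,
        hinvol y hy0 (by linarith [hy.2])⟩
  have hint : IntegrableOn (fun x => ‖fderiv ℝ w x‖ ^ 2) T := by
    have hc : Continuous fun x => ‖fderiv ℝ w x‖ ^ 2 :=
      (hw.continuous_fderiv one_ne_zero).norm.pow 2
    refine (hc.continuousOn.integrableOn_compact
      (isCompact_closedBall (0 : EuclideanSpace ℝ (Fin 3)) (r + δ))).mono_set fun x hx => ?_
    simpa using hx.2.le
  have hd' := fun x hx => (hd x hx).hasFDerivWithinAt (s := S)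
  rw [← himage] at hint ⊢
  rw [integral_image_eq_integral_abs_det_fderiv_smul volume hSm hd' hinj]
  refine integral_mono_of_nonneg (ae_of_all _ fun x => by positivity)
    ((integrableOn_image_iff_integrableOn_abs_det_fderiv_smul volume hSm hd' hinj _).1 hint) ?_
  filter_upwards [ae_restrict_mem hSm] with x hx
  have hx0 := hS0 x hx
  have hcomp := ((hw.differentiable one_ne_zero (φ x)).hasFDerivAt.comp x (hd x hx)).fderiv
  rw [hcomp, det_sphereReflectionFDeriv hx0 (by linarith [hx.2, norm_pos_iff.2 hx0]),
    finrank_euclideanSpace_fin, abs_neg, abs_of_nonneg (sq_nonneg _), smul_eq_mul, ← mul_pow,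
    mul_comm]
  gcongr
  exact (ContinuousLinearMap.opNorm_comp_le _ _).trans
    (by gcongr; exact norm_sphereReflectionFDeriv_le hx0 hx.2.le)
end
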